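/- Let x, y ∈ ℝ with y ≠ 0. Then the function y' ↦ ‖Γ(x + i·y')‖ has derivative at y equal to ‖Γ(x + i·y)‖ · ( −y/(x² + y²) − ∑_{n=1}^∞ y/((x + n)² + y²) ), and this derivative is strictly negative whenever y > 0. -/

import Mathlib

open Complex Real

open Filter Topology in
/-- The series `∑ 1 / ((x + n)² + c²)` converges. -/
lemma summable_one_div_add_sq_add_sq (x c : ℝ) :
    Summable fun n : ℕ => 1 / ((x + n) ^ 2 + c ^ 2) := by
  have h := (Real.summable_one_div_nat_add_rpow x 2).2 (by norm_num)
  refine Summable.of_norm_bounded_eventually_nat h ?_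
  filter_upwards [(tendsto_natCast_atTop_atTop (R := ℝ)).eventually_gt_atTop (-x)] with n hn
  have hpos : 0 < (n : ℝ) + x := by linarith
  rw [Real.norm_of_nonneg (by positivity), Real.rpow_two, sq_abs]
  gcongr
  nlinarith [sq_nonneg c]

lemma add_I_mul_add_natCast_ne_zero (x : ℝ) {t : ℝ} (ht : t ≠ 0) (n : ℕ) :
    (x : ℂ) + I * t + n ≠ 0 := by
  intro h
  exact ht (by simpa using congrArg Complex.im h)

lemma log_norm_add_I_mul_add_natCast (x t : ℝ) (n : ℕ) :
    Real.log ‖(x : ℂ) + I * t + n‖ = Real.log ((x + n) ^ 2 + t ^ 2) / 2 := by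
  have h : (x : ℂ) + I * t + n = ((x + n : ℝ) : ℂ) + (t : ℝ) * I := by push_cast; ring
  rw [h, Complex.norm_add_mul_I, Real.log_sqrt (by positivity)]

lemma log_norm_GammaSeq (x : ℝ) {t : ℝ} (ht : t ≠ 0) {n : ℕ} (hn : n ≠ 0) :
    Real.log ‖Complex.GammaSeq (x + I * t) n‖ =
      x * Real.log n + Real.log n.factorial -
        ∑ j ∈ Finset.range (n + 1), Real.log ((x + j) ^ 2 + t ^ 2) / 2 := by
  have hn' : (0 : ℝ) < n := by positivity
  have hprod : ∀ j ∈ Finset.range (n + 1), ‖(x : ℂ) + I * t + j‖ ≠ 0 := fun j _ =>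
    norm_ne_zero_iff.2 (add_I_mul_add_natCast_ne_zero x ht j)
  rw [Complex.GammaSeq, norm_div, norm_mul, norm_prod,
    Complex.norm_natCast_cpow_of_pos (Nat.pos_of_ne_zero hn), Complex.norm_natCast,
    Real.log_div (by positivity) (Finset.prod_ne_zero_iff.2 hprod),
    Real.log_mul (by positivity) (by positivity), Real.log_rpow hn', Real.log_prod hprod]
  simp [log_norm_add_I_mul_add_natCast]

lemma Gamma_add_I_mul_ne_zero (x : ℝ) {t : ℝ} (ht : t ≠ 0) :
    Complex.Gamma (x + I * t) ≠ 0 :=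
  Complex.Gamma_ne_zero fun m h =>
    add_I_mul_add_natCast_ne_zero x ht m (by rw [h]; ring)

open Filter Topology in
/-- The derivative of `t ↦ log ‖Γ(x + it)‖` away from the real axis. -/
lemma hasDerivAt_log_norm_Gamma (x : ℝ) {y : ℝ} (hy : y ≠ 0) :
    HasDerivAt (fun t : ℝ => Real.log ‖Complex.Gamma (x + I * t)‖)
      (-∑' n : ℕ, y / ((x + n) ^ 2 + y ^ 2)) y := by
  have hy' : 0 < |y| := abs_pos.2 hy
  have hball : ∀ t ∈ Metric.ball y (|y| / 2), |y| / 2 < |t| ∧ |t| < 2 * |y| := by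
    intro t ht
    rw [Metric.mem_ball, Real.dist_eq] at ht
    have h1 := abs_sub_abs_le_abs_sub t y
    have h2 := abs_sub_abs_le_abs_sub y t
    rw [abs_sub_comm] at h2
    constructor <;> linarith
  have hne : ∀ t ∈ Metric.ball y (|y| / 2), t ≠ 0 := fun t ht =>
    abs_pos.1 (by linarith [(hball t ht).1])
  have hunif : TendstoUniformlyOn
      (fun (n : ℕ) (t : ℝ) => ∑ j ∈ Finset.range n, t / ((x + j) ^ 2 + t ^ 2))
      (fun t => ∑' n : ℕ, t / ((x + n) ^ 2 + t ^ 2)) atTop (Metric.ball y (|y| / 2)) := by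
    refine tendstoUniformlyOn_tsum_nat
      ((summable_one_div_add_sq_add_sq x (|y| / 2)).mul_left (2 * |y|)) fun n t ht => ?_
    obtain ⟨h1, h2⟩ := hball t ht
    rw [Real.norm_eq_abs, abs_div, abs_of_nonneg (by positivity : 0 ≤ (x + n) ^ 2 + t ^ 2),
      mul_one_div, ← sq_abs t]
    gcongr
  refine hasDerivAt_of_tendstoUniformlyOn (l := atTop) Metric.isOpen_ball
    (f := fun (n : ℕ) (t : ℝ) => x * Real.log n + Real.log n.factorial -
        ∑ j ∈ Finset.range (n + 1), Real.log ((x + j) ^ 2 + t ^ 2) / 2)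
    (f' := fun (n : ℕ) (t : ℝ) => -∑ j ∈ Finset.range (n + 1), t / ((x + j) ^ 2 + t ^ 2))
    (g' := fun t => -∑' n : ℕ, t / ((x + n) ^ 2 + t ^ 2))
    ?_ (Eventually.of_forall fun n t ht => ?_) (fun t ht => ?_)
    (Metric.mem_ball_self (by positivity : 0 < |y| / 2))
  · exact (fun u hu => (tendsto_add_atTop_nat 1).eventually (hunif.neg u hu))
  · have ht0 := hne t ht
    refine (HasDerivAt.fun_sum fun j _ => ?_).const_sub _
    have hpos : (x + j) ^ 2 + t ^ 2 ≠ 0 := by positivity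
    refine ((((hasDerivAt_pow 2 t).const_add ((x + j) ^ 2)).log hpos).div_const 2).congr_deriv ?_
    simp
    field_simp
  · have ht0 := hne t ht
    refine Tendsto.congr' ?_ ((Complex.GammaSeq_tendsto_Gamma _).norm.log
      (norm_ne_zero_iff.2 (Gamma_add_I_mul_ne_zero x ht0)))
    filter_upwards [eventually_ne_atTop 0] with n hn
    exact log_norm_GammaSeq x ht0 hn

/-- Derivative in `y` of `y ↦ ‖Γ(x + iy)‖`, and its strict negativity for `y > 0`. -/
theorem stmt_9 (x y : ℝ) (hy : y ≠ 0) :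
    HasDerivAt (fun y' : ℝ => ‖Complex.Gamma (x + Complex.I * y')‖)
      (‖Complex.Gamma (x + Complex.I * y)‖ *
        (-(y / (x ^ 2 + y ^ 2)) -
          ∑' n : ℕ, y / ((x + ((n : ℝ) + 1)) ^ 2 + y ^ 2))) y ∧
    (0 < y →
      ‖Complex.Gamma (x + Complex.I * y)‖ *
        (-(y / (x ^ 2 + y ^ 2)) -
          ∑' n : ℕ, y / ((x + ((n : ℝ) + 1)) ^ 2 + y ^ 2)) < 0) := by
  have hpos : ∀ {t : ℝ}, t ≠ 0 → 0 < ‖Complex.Gamma (x + I * t)‖ := fun ht =>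
    norm_pos_iff.2 (Gamma_add_I_mul_ne_zero x ht)
  constructor
  · have hsum : Summable fun n : ℕ => y / ((x + n) ^ 2 + y ^ 2) := by
      simpa only [mul_one_div] using (summable_one_div_add_sq_add_sq x y).mul_left y
    have h := (hasDerivAt_log_norm_Gamma x hy).exp
    rw [Real.exp_log (hpos hy), hsum.tsum_eq_zero_add] at h
    refine (h.congr_of_eventuallyEq ?_).congr_deriv ?_
    · filter_upwards [isOpen_ne.mem_nhds hy] with t ht
      rw [Real.exp_log (hpos ht)]
    · push_cast
      ring_nf
  · intro hy0
    have htsum : 0 ≤ ∑' n : ℕ, y / ((x + ((n : ℝ) + 1)) ^ 2 + y ^ 2) :=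
      tsum_nonneg fun n => by positivity
    have hterm : 0 < y / (x ^ 2 + y ^ 2) := by positivity
    exact mul_neg_of_pos_of_neg (hpos hy) (by linarith)
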